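/- Let k be a field of characteristic zero, let K = k(t) be the rational function field over k, let p ≥ 3 be a prime, and define the trinomial φ_p(x) = x^p + ((−p·t^p − p·t)/(p·t^{p−1} + p − 1))·x^{p−1} + t over K. Then for every n ≥ 1, the splitting field K_n of φ_p^n over K satisfies [K_n : K] = (p!)^{1 + p + p² + ⋯ + p^{n−1}}. (This says that the arboreal representation of φ_p is surjective: Gal(K_n/K) equals the full automorphism group of the depth-n regular p-ary rooted tree for every n, hence G_K(φ_p) = Aut(T_p).) -/

import Mathlib

open Polynomial

/-- The `n`-fold iterate `φ^n` of a polynomial under composition (`φ^0 = x`). -/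
noncomputable def polyIter {R : Type*} [CommRing R] (φ : Polynomial R) : ℕ → Polynomial R
  | 0 => Polynomial.X
  | n + 1 => φ.comp (polyIter φ n)


section GroupTheory
open Equiv

/-- A subgroup of permutations containing all the swaps inside the fibres of `π` contains all
permutations preserving `π`. -/
lemma mem_of_fibre_swaps {R S : Type*} [Finite R] [DecidableEq R] (π : R → S)
    (H : Subgroup (Perm R))
    (hH : ∀ r s, π r = π s → swap r s ∈ H) (g : Perm R) (hg : π ∘ g = π) : g ∈ H := by
  classical
  cases nonempty_fintype R
  induction hn : g.support.card using Nat.strong_induction_on generalizing g with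
  | _ n ih =>
    by_cases h1 : g = 1
    · rw [h1]; exact H.one_mem
    · obtain ⟨x, hx⟩ : ∃ x, g x ≠ x := by
        by_contra! h; exact h1 (Equiv.ext h)
      have hgx : ∀ y, π (g y) = π y := fun y => congrFun hg y
      have key := ih _ (hn ▸ Perm.card_support_swap_mul hx) (swap x (g x) * g) (by
        funext y
        simp only [Function.comp, Perm.mul_apply]
        by_cases h2 : g y = x
        · rw [h2, swap_apply_left, hgx, ← h2, hgx]
        · by_cases h3 : g y = g x
          · rw [h3, swap_apply_right, ← hgx y, h3, hgx]
          · rw [swap_apply_of_ne_of_ne h2 h3, hgx]) rfl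
      have h2 := H.mul_mem (hH x (g x) (hgx x).symm) key
      rwa [← mul_assoc, swap_mul_self, one_mul] at h2

/-- Key group-theoretic fact: a transitive group, of prime block size, containing a
transposition, contains all swaps inside the blocks. -/
lemma fibre_swaps_mem {R S Γ : Type*} [Finite R] [DecidableEq R] [Group Γ]
    [MulAction Γ R] [MulAction Γ S] (π : R → S) (hπ : ∀ (γ : Γ) r, π (γ • r) = γ • π r)
    (p : ℕ) (hp : p.Prime) (hp3 : 3 ≤ p) (hfib : ∀ s, Nat.card {r // π r = s} = p)
    (htrans : MulAction.IsPretransitive Γ R)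
    (hswap : ∃ a b : R, a ≠ b ∧ swap a b ∈ (MulAction.toPermHom Γ R).range) :
    ∀ r s, π r = π s → swap r s ∈ (MulAction.toPermHom Γ R).range := by
  classical
  cases nonempty_fintype R
  set H := (MulAction.toPermHom Γ R).range with hHdef
  -- conjugation
  have hconj : ∀ (γ : Γ) r s, swap r s ∈ H → swap (γ • r) (γ • s) ∈ H := by
    intro γ r s h
    have hγ : MulAction.toPermHom Γ R γ ∈ H := ⟨γ, rfl⟩
    have := H.mul_mem (H.mul_mem hγ h) (H.inv_mem hγ)
    rwa [← Equiv.swap_apply_apply] at this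
  -- equivalence relation
  let e : Setoid R :=
    { r := fun r s => swap r s ∈ H
      iseqv :=
        { refl := fun r => by rw [swap_self]; exact H.one_mem
          symm := fun {r s} h => by rw [swap_comm]; exact h
          trans := fun {r s t} h1 h2 => by
            by_cases hrs : r = s
            · rwa [hrs]
            by_cases hrt : r = t
            · rw [hrt, swap_self]; exact H.one_mem
            have := H.mul_mem (H.mul_mem h2 h1) h2
            rwa [swap_mul_swap_mul_swap hrs hrt, swap_comm] at this } }
  -- the swap preserves the fibres
  have hfibre : ∀ r s, swap r s ∈ H → π r = π s := by
    rintro r s ⟨γ, hγ⟩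
    by_contra hne
    have hrs : r ≠ s := fun h => hne (by rw [h])
    have hact : ∀ x, γ • x = swap r s x := fun x => by
      rw [← hγ]; rfl
    have hcard : 1 < Nat.card {x // π x = π r} := by rw [hfib]; omega
    have : Nontrivial {x // π x = π r} := Finite.one_lt_card_iff_nontrivial.mp hcard
    obtain ⟨⟨x, hx⟩, hxr⟩ := exists_ne (⟨r, rfl⟩ : {x // π x = π r})
    have hxr' : x ≠ r := fun h => hxr (Subtype.ext h)
    have hxs : x ≠ s := fun h => hne (by rw [← h, hx])
    have h1 := hπ γ x
    rw [hact, swap_apply_of_ne_of_ne hxr' hxs, hx, ← hπ, hact, swap_apply_left] at h1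
    exact hne h1
  -- all classes have the same size
  have hsize : ∀ r s, Nat.card {x // swap r x ∈ H} = Nat.card {x // swap s x ∈ H} := by
    intro r s
    obtain ⟨γ, rfl⟩ := htrans.exists_smul_eq r s
    refine Nat.card_congr ((MulAction.toPerm γ).subtypeEquiv fun x => ⟨hconj γ r x, fun h => ?_⟩)
    have := hconj γ⁻¹ _ _ h
    simpa using this
  obtain ⟨a, b, hab, hswapab⟩ := hswap
  intro r s hrs
  set d := Nat.card {x // swap a x ∈ H} with hd
  have hd1 : 1 < d := by
    have : Nontrivial {x // swap a x ∈ H} :=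
      ⟨⟨a, by rw [swap_self]; exact H.one_mem⟩, ⟨b, hswapab⟩, fun h => hab (congrArg Subtype.val h)⟩
    exact Finite.one_lt_card_iff_nontrivial.mpr this
  have hdvd : d ∣ p := by
    let F := {x // π x = π r}
    let e' : Setoid F := e.comap Subtype.val
    have h1 : Nat.card F = ∑ q : Quotient e', Nat.card {x : F // (⟦x⟧ : Quotient e') = q} := by
      rw [← Nat.card_sigma]
      exact Nat.card_congr (Equiv.sigmaFiberEquiv _).symm
    have h2 : ∀ q : Quotient e', Nat.card {x : F // (⟦x⟧ : Quotient e') = q} = d := by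
      intro q
      induction q using Quotient.inductionOn with
      | _ y =>
      rw [hd, hsize a y.1]
      refine Nat.card_congr
        { toFun := fun x => ⟨x.1.1, by
            have : e'.r x.1 y := Quotient.exact x.2
            exact e.symm this⟩
          invFun := fun x => ⟨⟨x.1, by rw [← hfibre _ _ x.2]; exact y.2⟩, by
            apply Quotient.sound
            exact e.symm x.2⟩
          left_inv := fun x => rfl
          right_inv := fun x => rfl }
    rw [Finset.sum_congr rfl (fun q _ => h2 q), Finset.sum_const, hfib] at h1
    exact ⟨_, by rw [h1, smul_eq_mul, mul_comm]⟩
  have hdp : d = p := (hp.eq_one_or_self_of_dvd d hdvd).resolve_left (by omega)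
  -- the class of r fills the fibre
  have hinj : Function.Injective
      (fun x : {x // swap r x ∈ H} => (⟨x.1, (hfibre _ _ x.2).symm⟩ : {x // π x = π r})) :=
    fun x y h => Subtype.ext (congrArg (fun z => z.1) h)
  have hbij : Function.Bijective
      (fun x : {x // swap r x ∈ H} => (⟨x.1, (hfibre _ _ x.2).symm⟩ : {x // π x = π r})) := by
    rw [Nat.bijective_iff_injective_and_card]
    refine ⟨hinj, ?_⟩
    rw [hfib, hsize r a, ← hd, hdp]
  obtain ⟨⟨x, hx⟩, hxs⟩ := hbij.2 ⟨s, hrs.symm⟩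
  have : x = s := congrArg Subtype.val hxs
  rwa [← this]

lemma card_range_step {R S Γ : Type*} [Finite R] [Finite S] [Group Γ]
    [MulAction Γ R] [MulAction Γ S] (π : R → S) (hπ : ∀ (γ : Γ) r, π (γ • r) = γ • π r)
    (p : ℕ) (hp : p.Prime) (hp3 : 3 ≤ p) (hfib : ∀ s, Nat.card {r // π r = s} = p)
    (htrans : MulAction.IsPretransitive Γ R) [DecidableEq R]
    (hswap : ∃ a b : R, a ≠ b ∧ swap a b ∈ (MulAction.toPermHom Γ R).range) :
    Nat.card (MulAction.toPermHom Γ R).range =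
      p.factorial ^ (Nat.card S) * Nat.card (MulAction.toPermHom Γ S).range := by
  classical
  cases nonempty_fintype R
  cases nonempty_fintype S
  have hsurj : Function.Surjective π := by
    intro s
    have : 0 < Nat.card {r // π r = s} := by rw [hfib]; omega
    obtain ⟨⟨r, hr⟩⟩ := (Nat.card_pos_iff.mp this).1
    exact ⟨r, hr⟩
  have hmem := mem_of_fibre_swaps π _ (fibre_swaps_mem π hπ p hp hp3 hfib htrans hswap)
  have hle : (MulAction.toPermHom Γ R).ker ≤ (MulAction.toPermHom Γ S).ker := by
    intro γ hγ
    rw [MonoidHom.mem_ker] at hγ ⊢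
    ext s
    obtain ⟨r, rfl⟩ := hsurj s
    have : γ • r = r := congrFun (congrArg DFunLike.coe hγ) r
    simp [← hπ, this]
  rw [← Subgroup.index_ker, ← Subgroup.index_ker, ← Subgroup.relIndex_mul_index hle,
    Subgroup.relIndex_ker]
  congr 1
  have hset : ((MulAction.toPermHom Γ S).ker.map (MulAction.toPermHom Γ R) : Set (Perm R)) =
      {g : Perm R | π ∘ g = π} := by
    ext g
    constructor
    · rintro ⟨γ, hγ, rfl⟩
      have hγ' : MulAction.toPermHom Γ S γ = 1 := hγ
      funext r
      change π (γ • r) = π r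
      rw [hπ]
      exact congrFun (congrArg DFunLike.coe hγ') (π r)
    · intro hg
      obtain ⟨γ, rfl⟩ := hmem g hg
      refine ⟨γ, ?_, rfl⟩
      change MulAction.toPermHom Γ S γ = 1
      ext s
      obtain ⟨r, rfl⟩ := hsurj s
      change γ • π r = π r
      rw [← hπ]
      exact congrFun hg r
  have h1 : Nat.card ((MulAction.toPermHom Γ S).ker.map (MulAction.toPermHom Γ R)) =
      Set.ncard {g : Perm R | π ∘ g = π} := by
    rw [← hset]; rfl
  rw [h1, DomMulAct.stabilizer_ncard]
  have : ∀ s, Set.ncard {a | π a = s} = p := fun s => hfib s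
  simp [this]

end GroupTheory


section Inertia

universe u

lemma exists_swap_of_inertia {A K : Type u} [CommRing A] [IsDedekindDomain A] [Field K]
    [Algebra A K] [IsFractionRing A K] (L : Type u) [Field L] [Algebra K L]
    (F : A[X]) (hF : F.Monic) [IsSplittingField K L (F.map (algebraMap A K))]
    (hsep : (F.map (algebraMap A K)).Separable)
    (m : Ideal A) [m.IsMaximal] [PerfectField m.ResidueField]
    (c : A) (hm : m = Ideal.span {F.eval c}) (hm0 : m ≠ ⊥) (hc' : F.derivative.eval c ∈ m)
    (hsimple : ∀ (E : Type u) [Field E] (f : A →+* E), (∀ a ∈ m, f a = 0) →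
      ∀ x : E, F.eval₂ f x = 0 → F.derivative.eval₂ f x = 0 → x = f c)
    (htwo : ∀ (E : Type u) [Field E] (f : A →+* E), (∀ a ∈ m, f a = 0) →
      F.derivative.derivative.eval₂ f (f c) ≠ 0) :
    ∃ σ : Gal(L/K), ∃ a b : L, a ≠ b ∧ a ∈ (F.map (algebraMap A K)).rootSet L ∧
      b ∈ (F.map (algebraMap A K)).rootSet L ∧ σ a = b ∧ σ b = a ∧
      ∀ x ∈ (F.map (algebraMap A K)).rootSet L, x ≠ a → x ≠ b → σ x = x := by
  classical
  set FK := F.map (algebraMap A K) with hFK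
  have hFKm : FK.Monic := hF.map _
  have : IsGalois K L := IsGalois.of_separable_splitting_field hsep
  have : FiniteDimensional K L := IsSplittingField.finiteDimensional L FK
  let : Algebra A L := ((algebraMap K L).comp (algebraMap A K)).toAlgebra
  have : IsScalarTower A K L := IsScalarTower.of_algebraMap_eq fun _ => rfl
  let B := integralClosure A L
  have : IsDedekindDomain B := IsIntegralClosure.isDedekindDomain A K L B
  have : Module.Finite A B := IsIntegralClosure.finite A K L B
  have : IsFractionRing B L := IsIntegralClosure.isFractionRing_of_finite_extension A K L B
  let : MulSemiringAction Gal(L/K) B := IsIntegralClosure.MulSemiringAction A K L B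
  have : IsGaloisGroup Gal(L/K) A B := IsGaloisGroup.of_isFractionRing _ _ _ K L
  have : FaithfulSMul A L := by
    rw [faithfulSMul_iff_algebraMap_injective]
    exact (algebraMap K L).injective.comp (IsFractionRing.injective A K)
  have hinjBL : Function.Injective (algebraMap B L) := IsFractionRing.injective B L
  have hsmul : ∀ (σ : Gal(L/K)) (b : B), algebraMap B L (σ • b) = σ (algebraMap B L b) :=
    fun σ b => algebraMap_galRestrict_apply A σ b
  -- the prime above
  obtain ⟨⟨P, hPp, hPo⟩⟩ := (inferInstance : Nonempty (Ideal.primesOver m B))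
  -- factor F over B
  set FB := F.map (algebraMap A B) with hFB
  set FL := FK.map (algebraMap K L) with hFL
  have hFBL : FB.map (algebraMap B L) = FL := by
    rw [hFB, hFL, hFK, Polynomial.map_map, Polynomial.map_map, ← IsScalarTower.algebraMap_eq,
      ← IsScalarTower.algebraMap_eq]
  have hsplit : FL.Splits := IsSplittingField.splits L FK
  have hFLm : FL.Monic := hFKm.map _
  obtain ⟨M, hM⟩ : ∃ M : Multiset B, M.map (algebraMap B L) = FL.roots := by
    have : ∀ x ∈ FL.roots, ∃ b : B, algebraMap B L b = x := by
      intro x hx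
      have hx' := (mem_roots'.mp hx).2
      refine ⟨⟨x, F, hF, ?_⟩, rfl⟩
      rw [IsRoot.def, hFL, hFK, Polynomial.map_map, eval_map, ← IsScalarTower.algebraMap_eq] at hx'
      exact hx'
    revert this
    induction FL.roots using Multiset.induction_on with
    | empty => exact fun _ => ⟨0, rfl⟩
    | cons a s ih =>
      intro this
      obtain ⟨M, hM⟩ := ih fun x hx => this x (Multiset.mem_cons_of_mem hx)
      obtain ⟨b, hb⟩ := this a (Multiset.mem_cons_self a s)
      exact ⟨b ::ₘ M, by rw [Multiset.map_cons, hM, hb]⟩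
  have hFBprod : FB = (M.map fun r => X - C r).prod := by
    apply Polynomial.map_injective _ hinjBL
    rw [hFBL, Polynomial.map_multiset_prod, Multiset.map_map]
    conv_lhs => rw [hsplit.eq_prod_roots_of_monic hFLm]
    rw [← hM, Multiset.map_map]
    congr 1
    refine Multiset.map_congr rfl fun x _ => ?_
    simp
  have hMnodup : M.Nodup := by
    apply Multiset.Nodup.of_map (algebraMap B L)
    rw [hM]
    exact nodup_roots (hsep.map)
  have hroot : ∀ x : L, x ∈ FK.rootSet L ↔ ∃ r ∈ M, algebraMap B L r = x := by
    intro x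
    rw [← Multiset.mem_map, hM, mem_rootSet', mem_roots', IsRoot.def, hFL, eval_map_algebraMap]
  -- residue field
  have : P.IsMaximal := Ideal.IsMaximal.of_liesOver_isMaximal P m
  let : Field (B ⧸ P) := Ideal.Quotient.field P
  let q : B →+* B ⧸ P := Ideal.Quotient.mk P
  let f : A →+* B ⧸ P := q.comp (algebraMap A B)
  have hf : ∀ a ∈ m, f a = 0 := by
    intro a ha
    refine Ideal.Quotient.eq_zero_iff_mem.mpr ?_
    rw [hPo.over] at ha
    exact ha
  have hFE : F.map f = FB.map q := by rw [hFB, Polynomial.map_map]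
  have hd0 : ∀ x, F.eval₂ f x = (FB.map q).eval x := fun x => by rw [← hFE, eval_map]
  have hd1 : ∀ x, F.derivative.eval₂ f x = (FB.map q).derivative.eval x := fun x => by
    rw [← hFE, derivative_map, eval_map]
  have hd2 : ∀ x, F.derivative.derivative.eval₂ f x = (FB.map q).derivative.derivative.eval x :=
    fun x => by rw [← hFE, derivative_map, derivative_map, eval_map]
  have hpair : ∀ r ∈ M, ∀ s ∈ M, r ≠ s → q r = q s → q r = f c := by
    intro r hr s hs hrs hq
    obtain ⟨M1, rfl⟩ := Multiset.exists_cons_of_mem hr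
    have hs1 : s ∈ M1 := (Multiset.mem_cons.mp hs).resolve_left (Ne.symm hrs)
    obtain ⟨M2, rfl⟩ := Multiset.exists_cons_of_mem hs1
    rw [Multiset.map_cons, Multiset.map_cons, Multiset.prod_cons, Multiset.prod_cons] at hFBprod
    apply hsimple _ f hf
    · rw [hd0, hFBprod]; simp
    · rw [hd1, hFBprod]; simp [hq]
  have htriple : ∀ r ∈ M, ∀ s ∈ M, ∀ u ∈ M, r ≠ s → r ≠ u → s ≠ u → q r = f c → q s = f c →
      q u = f c → False := by
    intro r hr s hs u hu hrs hru hsu h1 h2 h3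
    obtain ⟨M1, rfl⟩ := Multiset.exists_cons_of_mem hr
    have hs1 : s ∈ M1 := (Multiset.mem_cons.mp hs).resolve_left (Ne.symm hrs)
    have hu1 : u ∈ M1 := (Multiset.mem_cons.mp hu).resolve_left (Ne.symm hru)
    obtain ⟨M2, rfl⟩ := Multiset.exists_cons_of_mem hs1
    have hu2 : u ∈ M2 := (Multiset.mem_cons.mp hu1).resolve_left (Ne.symm hsu)
    obtain ⟨M3, rfl⟩ := Multiset.exists_cons_of_mem hu2
    rw [Multiset.map_cons, Multiset.map_cons, Multiset.map_cons, Multiset.prod_cons,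
      Multiset.prod_cons, Multiset.prod_cons] at hFBprod
    apply htwo _ f hf
    rw [hd2, hFBprod]
    simp [h1, h2, h3]
  -- two roots over c
  set cB := algebraMap A B c with hcB
  have hFcP : FB.eval cB ∈ P := by
    have h1 : F.eval c ∈ m := by rw [hm]; exact Ideal.mem_span_singleton_self _
    rw [hPo.over] at h1
    rw [hFB, hcB, eval_map_algebraMap, aeval_algebraMap_apply_eq_algebraMap_eval]
    exact h1
  have hFc'P : FB.derivative.eval cB ∈ P := by
    rw [hPo.over] at hc'
    rw [hFB, hcB, derivative_map, eval_map_algebraMap, aeval_algebraMap_apply_eq_algebraMap_eval]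
    exact hc'
  obtain ⟨r, s, hr, hs, hrs, hrP, hsP, hsq⟩ : ∃ r s, r ∈ M ∧ s ∈ M ∧ r ≠ s ∧ cB - r ∈ P ∧
      cB - s ∈ P ∧ FB.eval cB ∈ P ^ 2 := by
    have hev : ∀ N : Multiset B, ((N.map fun r => X - C r).prod).eval cB =
        (N.map fun r => cB - r).prod := by
      intro N
      rw [eval_multiset_prod, Multiset.map_map]
      simp
    have hmem : ∀ N : Multiset B, ((N.map fun r => X - C r).prod).eval cB ∈ P →
        ∃ r ∈ N, cB - r ∈ P := by
      intro N hN
      rw [hev] at hN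
      obtain ⟨y, hy, hyP⟩ := (hPp.multiset_prod_mem_iff_exists_mem _).mp hN
      obtain ⟨r, hr, rfl⟩ := Multiset.mem_map.mp hy
      exact ⟨r, hr, hyP⟩
    obtain ⟨r, hr, hrP⟩ := hmem M (hFBprod ▸ hFcP)
    obtain ⟨M1, rfl⟩ := Multiset.exists_cons_of_mem hr
    rw [Multiset.map_cons, Multiset.prod_cons] at hFBprod
    have h2 : ((M1.map fun r => X - C r).prod).eval cB ∈ P := by
      rw [hFBprod, derivative_mul, eval_add, eval_mul, eval_mul] at hFc'P
      simp only [derivative_sub, derivative_X, derivative_C, sub_zero, eval_one, one_mul, eval_sub,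
        eval_X, eval_C] at hFc'P
      exact (P.add_mem_iff_left (P.mul_mem_right _ hrP)).mp hFc'P
    obtain ⟨s, hs, hsP⟩ := hmem M1 h2
    refine ⟨r, s, hr, Multiset.mem_cons_of_mem hs, ?_, hrP, hsP, ?_⟩
    · rintro rfl
      exact (Multiset.nodup_cons.mp hMnodup).1 hs
    · rw [hFBprod, eval_mul, pow_two]
      refine Ideal.mul_mem_mul ?_ h2
      simpa using hrP
  -- ramification
  have hram : 2 ≤ P.ramificationIdx A := by
    have : P.LiesOver m := hPo
    have hmap0 : m.map (algebraMap A B) ≠ ⊥ := by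
      rw [Ne, Ideal.map_eq_bot_iff_of_injective (FaithfulSMul.algebraMap_injective A B)]
      exact hm0
    rw [← Ideal.ramificationIdx'_eq_ramificationIdx' m P hmap0]
    have hle : m.map (algebraMap A B) ≤ P ^ 2 := by
      rw [hm, Ideal.map_span, Set.image_singleton, Ideal.span_singleton_le_iff_mem]
      rw [hFB, hcB, eval_map_algebraMap, aeval_algebraMap_apply_eq_algebraMap_eval] at hsq
      exact hsq
    by_contra hlt
    have h1 := Ideal.ramificationIdx'_ne_one_iff (p := m) (P := P) (hle.trans (Ideal.pow_le_self two_ne_zero))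
    have h0 := Ideal.IsDedekindDomain.ramificationIdx'_ne_zero hmap0 hPp (hle.trans (Ideal.pow_le_self two_ne_zero))
    have := h1.mpr hle
    omega
  have hcard : 1 < Nat.card (P.inertia Gal(L/K)) := by
    have : P.LiesOver m := hPo
    rw [Ideal.card_inertia_eq_ramificationIdxIn m P,
      Ideal.ramificationIdxIn_eq_ramificationIdx m P Gal(L/K)]
    omega
  have : Nontrivial (P.inertia Gal(L/K)) := Finite.one_lt_card_iff_nontrivial.mp hcard
  obtain ⟨⟨σ, hσ⟩, hσ1⟩ := exists_ne (1 : P.inertia Gal(L/K))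
  have hσ1' : σ ≠ 1 := fun h => hσ1 (Subtype.ext h)
  have hσP : ∀ b : B, q (σ • b) = q b := by
    intro b
    exact Ideal.Quotient.eq.mpr (hσ b)
  have hσM : ∀ x ∈ M, σ • x ∈ M := by
    intro x hx
    have h1 : algebraMap B L x ∈ FK.rootSet L := (hroot _).mpr ⟨x, hx, rfl⟩
    have h2 : σ (algebraMap B L x) ∈ FK.rootSet L := by
      rw [mem_rootSet'] at h1 ⊢
      refine ⟨h1.1, ?_⟩
      rw [aeval_algHom_apply, h1.2, map_zero]
    obtain ⟨y, hy, hyx⟩ := (hroot _).mp h2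
    rw [← hsmul] at hyx
    rwa [← hinjBL hyx]
  have hqr : q r = f c := (Ideal.Quotient.eq.mpr hrP).symm
  have hqs : q s = f c := (Ideal.Quotient.eq.mpr hsP).symm
  have hmove : ∀ x ∈ M, σ • x ≠ x → x = r ∨ x = s := by
    intro x hx hne
    have h1 := hpair (σ • x) (hσM x hx) x hx hne (hσP x)
    rw [hσP] at h1
    by_contra! hcon
    exact htriple r hr s hs x hx hrs (Ne.symm hcon.1) (Ne.symm hcon.2) hqr hqs h1
  have himg : ∀ x ∈ M, q x = f c → x = r ∨ x = s := by
    intro x hx h1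
    by_contra! hcon
    exact htriple r hr s hs x hx hrs (Ne.symm hcon.1) (Ne.symm hcon.2) hqr hqs h1
  have hr' := himg _ (hσM r hr) (by rw [hσP, hqr])
  have hs' := himg _ (hσM s hs) (by rw [hσP, hqs])
  have hfix : ∀ x ∈ M, x ≠ r → x ≠ s → σ • x = x := by
    intro x hx h1 h2
    by_contra hne
    rcases hmove x hx hne with h | h
    · exact h1 h
    · exact h2 h
  have hinjσ : ∀ x y : B, σ • x = σ • y → x = y := fun x y h => smul_left_cancel σ h
  have hswap : σ • r = s ∧ σ • s = r := by
    rcases hr' with h1 | h1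
    · exfalso
      have h2 : σ • s = s := by
        rcases hs' with h2 | h2
        · exact absurd (hinjσ r s (h1.trans h2.symm)) hrs
        · exact h2
      apply hσ1'
      have hall : ∀ x ∈ M, σ • x = x := by
        intro x hx
        by_cases hxr : x = r
        · rw [hxr, h1]
        by_cases hxs : x = s
        · rw [hxs, h2]
        exact hfix x hx hxr hxs
      have htop := IsSplittingField.adjoin_rootSet L FK
      apply AlgEquiv.ext
      intro y
      have hy : y ∈ Algebra.adjoin K (FK.rootSet L) := by rw [htop]; trivial
      have hEq : Set.EqOn (σ : L →ₐ[K] L) (AlgHom.id K L) (FK.rootSet L) := by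
        intro z hz
        obtain ⟨b, hb, rfl⟩ := (hroot z).mp hz
        change σ (algebraMap B L b) = algebraMap B L b
        rw [← hsmul, hall b hb]
      exact AlgHom.adjoin_le_equalizer _ _ hEq hy
    · refine ⟨h1, ?_⟩
      rcases hs' with h2 | h2
      · exact h2
      · exact absurd (hinjσ r s (h1.trans h2.symm)) hrs
  refine ⟨σ, algebraMap B L r, algebraMap B L s, fun h => hrs (hinjBL h),
    (hroot _).mpr ⟨r, hr, rfl⟩, (hroot _).mpr ⟨s, hs, rfl⟩, ?_, ?_, ?_⟩
  · rw [← hsmul, hswap.1]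
  · rw [← hsmul, hswap.2]
  · intro x hx h1 h2
    obtain ⟨b, hb, rfl⟩ := (hroot x).mp hx
    rw [← hsmul, hfix b hb (fun h => h1 (by rw [h])) (fun h => h2 (by rw [h]))]

end Inertia

section Iterates

lemma polyIter_succ' {R : Type*} [CommRing R] (φ : R[X]) (n : ℕ) :
    polyIter φ (n + 1) = (polyIter φ n).comp φ := by
  induction n with
  | zero => simp [polyIter]
  | succ n ih =>
    change φ.comp (polyIter φ (n + 1)) = (φ.comp (polyIter φ n)).comp φ
    rw [comp_assoc, ← ih]

lemma polyIter_map {R S : Type*} [CommRing R] [CommRing S] (f : R →+* S) (φ : R[X]) (n : ℕ) :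
    (polyIter φ n).map f = polyIter (φ.map f) n := by
  induction n with
  | zero => simp [polyIter]
  | succ n ih => simp [polyIter, Polynomial.map_comp, ih]

lemma polyIter_monic {R : Type*} [CommRing R] [IsDomain R] (φ : R[X]) (hφ : φ.Monic)
    (hd : φ.natDegree ≠ 0) (n : ℕ) :
    (polyIter φ n).Monic ∧ (polyIter φ n).natDegree = φ.natDegree ^ n := by
  induction n with
  | zero => exact ⟨monic_X, by simp [polyIter]⟩
  | succ n ih =>
    refine ⟨hφ.comp ih.1 ?_, ?_⟩
    · rw [ih.2]; exact pow_ne_zero _ hd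
    · change (φ.comp (polyIter φ n)).natDegree = _
      rw [natDegree_comp, ih.2, pow_succ, mul_comm]

end Iterates

section Counting

variable {K : Type*} [Field K]

open Equiv

/-- The permutation action of the absolute Galois group on the roots of a polynomial. -/
@[reducible] noncomputable def absGalAction (P : K[X]) (Ω : Type*) [Field Ω] [Algebra K Ω]
    [IsAlgClosed Ω] : MulAction Gal(Ω/K) (P.rootSet Ω) :=
  letI : Fact ((P.map (algebraMap K Ω)).Splits) := ⟨IsAlgClosed.splits _⟩
  MulAction.compHom _ (Gal.restrict P Ω)

lemma absGal_smul (P : K[X]) (Ω : Type*) [Field Ω] [Algebra K Ω]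
    [IsAlgClosed Ω] (γ : Gal(Ω/K)) (x : P.rootSet Ω) :
    letI := absGalAction P Ω
    ((γ • x : P.rootSet Ω) : Ω) = γ x := by
  let : Fact ((P.map (algebraMap K Ω)).Splits) := ⟨IsAlgClosed.splits _⟩
  exact Gal.restrict_smul γ x

lemma absGal_card (P : K[X]) (hP : P.Separable) (Ω : Type*) [Field Ω] [Algebra K Ω]
    [IsAlgClosure K Ω] [IsAlgClosed Ω] [Normal K Ω] :
    letI := absGalAction P Ω
    Nat.card (MulAction.toPermHom Gal(Ω/K) (P.rootSet Ω)).range =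
      Module.finrank K P.SplittingField := by
  let : Fact ((P.map (algebraMap K Ω)).Splits) := ⟨IsAlgClosed.splits _⟩
  let := absGalAction P Ω
  have h1 : MulAction.toPermHom Gal(Ω/K) (P.rootSet Ω) =
      (Gal.galActionHom P Ω).comp (Gal.restrict P Ω) :=
    MonoidHom.ext fun γ => Equiv.ext fun x => rfl
  rw [h1, MonoidHom.range_comp, MonoidHom.range_eq_top.mpr (Gal.restrict_surjective P Ω),
    ← MonoidHom.range_eq_map, ← Gal.card_of_separable hP]
  exact (Nat.card_congr (MonoidHom.ofInjective (Gal.galActionHom_injective P Ω)).toEquiv).symm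

lemma absGal_swap (P : K[X]) (Ω : Type*) [Field Ω] [Algebra K Ω] [IsAlgClosed Ω] [Normal K Ω]
    [DecidableEq (P.rootSet Ω)]
    (h : ∃ σ : Gal(P.SplittingField/K), ∃ a b : P.SplittingField, a ≠ b ∧
      a ∈ P.rootSet P.SplittingField ∧
      b ∈ P.rootSet P.SplittingField ∧ σ a = b ∧ σ b = a ∧
      ∀ x ∈ P.rootSet P.SplittingField, x ≠ a → x ≠ b → σ x = x) :
    letI := absGalAction P Ω
    ∃ a b : P.rootSet Ω, a ≠ b ∧ swap a b ∈ (MulAction.toPermHom Gal(Ω/K) (P.rootSet Ω)).range := by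
  let : Fact ((P.map (algebraMap K Ω)).Splits) := ⟨IsAlgClosed.splits _⟩
  let := absGalAction P Ω
  obtain ⟨σ, a, b, hab, ha, hb, h1, h2, h3⟩ := h
  obtain ⟨γ, hγ⟩ := Gal.restrict_surjective P Ω σ
  let e := Gal.rootsEquivRoots P Ω
  refine ⟨e ⟨a, ha⟩, e ⟨b, hb⟩, fun h => hab (congrArg Subtype.val (e.injective h)), γ, ?_⟩
  ext1 x
  obtain ⟨y, rfl⟩ := e.surjective x
  have h4 : MulAction.toPermHom Gal(Ω/K) (P.rootSet Ω) γ (e y) =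
      e ((Gal.restrict P Ω γ) • (e.symm (e y))) := rfl
  rw [h4, hγ, e.symm_apply_apply]
  by_cases hya : y = ⟨a, ha⟩
  · rw [hya, swap_apply_left]
    exact congrArg e (Subtype.ext h1)
  by_cases hyb : y = ⟨b, hb⟩
  · rw [hyb, swap_apply_right]
    exact congrArg e (Subtype.ext h2)
  rw [swap_apply_of_ne_of_ne (fun h => hya (e.injective h)) (fun h => hyb (e.injective h))]
  refine congrArg e (Subtype.ext (h3 _ y.2 (fun h => hya (Subtype.ext h))
    (fun h => hyb (Subtype.ext h))))

lemma absGal_trans (P : K[X]) (hP : Irreducible P) (Ω : Type*) [Field Ω] [Algebra K Ω]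
    [IsAlgClosed Ω] [Normal K Ω] :
    letI := absGalAction P Ω
    MulAction.IsPretransitive Gal(Ω/K) (P.rootSet Ω) := by
  let : Fact ((P.map (algebraMap K Ω)).Splits) := ⟨IsAlgClosed.splits _⟩
  let := absGalAction P Ω
  have := Gal.galAction_isPretransitive (p := P) (E := Ω) hP
  refine ⟨fun x y => ?_⟩
  obtain ⟨σ, hσ⟩ := this.exists_smul_eq x y
  obtain ⟨γ, rfl⟩ := Gal.restrict_surjective P Ω σ
  exact ⟨γ, hσ⟩

theorem finrank_of_swaps [CharZero K] (φ : K[X]) (hφ : φ.Monic) (p : ℕ) (hdeg : φ.natDegree = p)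
    (hp : p.Prime) (hp3 : 3 ≤ p) (hirr : ∀ n, Irreducible (polyIter φ n))
    (hsw : ∀ n, 1 ≤ n → 
      ∃ σ : Gal((polyIter φ n).SplittingField/K), ∃ a b : (polyIter φ n).SplittingField, a ≠ b ∧
      a ∈ (polyIter φ n).rootSet (polyIter φ n).SplittingField ∧
      b ∈ (polyIter φ n).rootSet (polyIter φ n).SplittingField ∧ σ a = b ∧ σ b = a ∧
      ∀ x ∈ (polyIter φ n).rootSet (polyIter φ n).SplittingField, x ≠ a → x ≠ b → σ x = x)
    (n : ℕ) :
    Module.finrank K (polyIter φ n).SplittingField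
      = (Nat.factorial p) ^ (∑ i ∈ Finset.range n, p ^ i) := by
  classical
  let Ω := AlgebraicClosure K
  have hmon := polyIter_monic φ hφ (by omega)
  have hsepn : ∀ n, (polyIter φ n).Separable := fun n => (hirr n).separable
  induction n with
  | zero =>
    rw [Finset.range_zero, Finset.sum_empty, pow_zero]
    have : (⊤ : Subalgebra K (polyIter φ 0).SplittingField) = ⊥ := by
      have h := SplittingField.adjoin_rootSet (polyIter φ 0)
      rw [← h, eq_bot_iff]
      apply Algebra.adjoin_le
      intro x hx
      have := (mem_rootSet'.mp hx).2
      have aux : ∀ (E : Type _) [Field E] [Algebra K E] (x : E),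
          aeval x (polyIter φ 0) = 0 → x = 0 := by
        intro E _ _ x h; simpa [polyIter] using h
      rw [aux _ _ this]; exact Subalgebra.zero_mem _
    exact Subalgebra.bot_eq_top_iff_finrank_eq_one.mp this.symm
  | succ n ih =>
    let := absGalAction (polyIter φ n) Ω
    let := absGalAction (polyIter φ (n+1)) Ω
    have hroot : ∀ x, x ∈ (polyIter φ (n+1)).rootSet Ω ↔ aeval x φ ∈ (polyIter φ n).rootSet Ω := by
      intro x
      rw [mem_rootSet, mem_rootSet, polyIter_succ' φ n, aeval_comp, ← polyIter_succ']
      simp [(hmon _).1.ne_zero]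
    let π : (polyIter φ (n+1)).rootSet Ω → (polyIter φ n).rootSet Ω :=
      fun x => ⟨aeval x.1 φ, (hroot _).mp x.2⟩
    have hπ : ∀ (γ : Gal(Ω/K)) r, π (γ • r) = γ • π r := by
      intro γ r
      apply Subtype.ext
      rw [absGal_smul]
      change aeval ((γ • r : (polyIter φ (n+1)).rootSet Ω) : Ω) φ = γ (aeval r.1 φ)
      rw [absGal_smul, ← aeval_algHom_apply]
    have hfib : ∀ s, Nat.card {r // π r = s} = p := by
      intro s
      let ψ : Polynomial Ω := φ.map (algebraMap K Ω) - C s.1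
      have hφΩ : (φ.map (algebraMap K Ω)).natDegree = p := by rw [natDegree_map, hdeg]
      have hψdeg : ψ.natDegree = p := by
        rw [natDegree_sub_C, hφΩ]
      have hψ0 : ψ ≠ 0 := by
        intro h; rw [h, natDegree_zero] at hψdeg; omega
      have hψev : ∀ x, ψ.eval x = aeval x φ - s.1 := by
        intro x; simp [ψ, eval_map_algebraMap]
      have hψsep : ψ.Separable := by
        have h1 : ((polyIter φ (n+1)).map (algebraMap K Ω)).Separable := (hsepn _).map
        refine h1.of_dvd ?_
        rw [polyIter_succ', Polynomial.map_comp]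
        have h2 : (X - C s.1) ∣ (polyIter φ n).map (algebraMap K Ω) := by
          rw [dvd_iff_isRoot, IsRoot.def, eval_map_algebraMap]
          exact (mem_rootSet'.mp s.2).2
        obtain ⟨g, hg⟩ := h2
        rw [hg, mul_comp]
        refine Dvd.intro (g.comp (φ.map (algebraMap K Ω))) ?_
        simp [ψ]
      have hcard : ψ.roots.toFinset.card = p := by
        rw [Multiset.toFinset_card_of_nodup (nodup_roots hψsep), ← hψdeg]
        exact (IsAlgClosed.splits ψ).natDegree_eq_card_roots.symm
      have hmem : ∀ x, x ∈ ψ.roots.toFinset ↔ aeval x φ = s.1 := by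
        intro x
        rw [Multiset.mem_toFinset, mem_roots hψ0, IsRoot.def, hψev, sub_eq_zero]
      rw [← hcard, ← Nat.card_eq_finsetCard]
      refine Nat.card_congr ⟨fun r => ⟨r.1.1, (hmem _).mpr (congrArg Subtype.val r.2)⟩,
        fun x => ⟨⟨x.1, (hroot _).mpr (by rw [(hmem _).mp x.2]; exact s.2)⟩,
          Subtype.ext ((hmem _).mp x.2)⟩, fun r => rfl, fun x => rfl⟩
    have := card_range_step π hπ p hp hp3 hfib
      (absGal_trans _ (hirr _) Ω) (absGal_swap _ Ω (hsw (n+1) (by omega)))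
    rw [absGal_card _ (hsepn _), absGal_card _ (hsepn _), ih] at this
    rw [this, Finset.sum_range_succ, add_comm, pow_add]
    congr 2
    rw [Nat.card_eq_fintype_card, card_rootSet_eq_natDegree (hsepn n) (IsAlgClosed.splits _),
      (hmon n).2, hdeg]

end Counting

section Tri

/-- The trinomial `x^p + a x^(p-1) + t`. -/
noncomputable def tri {R : Type*} [CommRing R] (p : ℕ) (a t : R) : R[X] :=
  X ^ p + C a * X ^ (p - 1) + C t

lemma tri_map {R S : Type*} [CommRing R] [CommRing S] (f : R →+* S) (p : ℕ) (a t : R) :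
    (tri p a t).map f = tri p (f a) (f t) := by
  simp [tri]

lemma tri_monic {R : Type*} [CommRing R] [Nontrivial R] (p : ℕ) (hp : 3 ≤ p) (a t : R) :
    (tri p a t).Monic ∧ (tri p a t).natDegree = p := by
  have h : (C a * X ^ (p - 1) + C t).degree < (p : WithBot ℕ) := by
    refine lt_of_le_of_lt (degree_add_le _ _) (max_lt ?_ ?_)
    · refine lt_of_le_of_lt (degree_C_mul_X_pow_le _ _) ?_
      exact_mod_cast (by omega : p - 1 < p)
    · refine lt_of_le_of_lt degree_C_le ?_
      exact_mod_cast (by omega : 0 < p)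
  have h1 : tri p a t = X ^ p + (C a * X ^ (p - 1) + C t) := by rw [tri, add_assoc]
  rw [h1]
  exact ⟨monic_X_pow_add h, natDegree_eq_of_degree_eq_some (by
    rw [degree_add_eq_left_of_degree_lt (by rwa [degree_X_pow]), degree_X_pow])⟩

lemma polyIter_eval {R : Type*} [CommRing R] (φ : R[X]) (n : ℕ) (x : R) :
    (polyIter φ n).eval x = (fun y => φ.eval y)^[n] x := by
  induction n with
  | zero => simp [polyIter]
  | succ n ih => rw [Function.iterate_succ_apply', ← ih]; simp [polyIter, eval_comp]

lemma polyIter_deriv_eval {R : Type*} [CommRing R] (φ : R[X]) (n : ℕ) (x : R) :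
    (polyIter φ n).derivative.eval x =
      ∏ j ∈ Finset.range n, φ.derivative.eval ((fun y => φ.eval y)^[j] x) := by
  induction n with
  | zero => simp [polyIter]
  | succ n ih =>
    rw [Finset.prod_range_succ, ← ih, ← polyIter_eval]
    simp [polyIter, derivative_comp, eval_comp]

lemma tri_deriv {R : Type*} [CommRing R] (p : ℕ) (hp : 3 ≤ p) (a t : R) :
    (tri p a t).derivative = X ^ (p - 2) * (C (p : R) * X + C (((p : R) - 1) * a)) := by
  obtain ⟨q, rfl⟩ : ∃ q, p = q + 3 := ⟨p - 3, by omega⟩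
  simp only [tri, derivative_add, derivative_X_pow, derivative_C_mul_X_pow, derivative_C]
  simp only [show q + 3 - 1 = q + 2 by omega, show q + 3 - 2 = q + 1 by omega,
    show q + 2 - 1 = q + 1 by omega]
  push_cast
  simp only [C_mul, C_add, C_sub, map_natCast, C_1, map_ofNat]
  ring

lemma tri_deriv_eval {R : Type*} [CommRing R] (p : ℕ) (hp : 3 ≤ p) (a t x : R) :
    (tri p a t).derivative.eval x = x ^ (p - 2) * ((p : R) * x + ((p : R) - 1) * a) := by
  rw [tri_deriv p hp]; simp

lemma polyIter_tri_deriv_c {R : Type*} [CommRing R] (p : ℕ) (hp : 3 ≤ p) (a t c : R)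
    (hc : (p : R) * c = -(((p : R) - 1) * a)) (n : ℕ) (hn : 1 ≤ n) :
    (polyIter (tri p a t) n).derivative.eval c = 0 := by
  rw [polyIter_deriv_eval]
  refine Finset.prod_eq_zero (Finset.mem_range.mpr hn) ?_
  rw [Function.iterate_zero_apply, tri_deriv_eval p hp, hc]; ring

lemma tri_iter_c {R : Type*} [CommRing R] (p : ℕ) (hp : 3 ≤ p) (a t c : R)
    (hct : (tri p a t).eval t = c) (j : ℕ) : (fun y => (tri p a t).eval y)^[j] c =
    (fun y => (tri p a t).eval y)^[j + 2] 0 := by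
  rw [Function.iterate_add_apply]
  congr 1
  have : (tri p a t).eval 0 = t := by
    simp [tri, show p ≠ 0 by omega, show p - 1 ≠ 0 by omega]
  change c = (tri p a t).eval ((tri p a t).eval 0)
  rw [this, hct]

lemma tri_crit {E : Type*} [Field E] [CharZero E] (p : ℕ) (hp : 3 ≤ p) (a t c : E)
    (hc : (p : E) * c = -(((p : E) - 1) * a))
    (x : E) (hx : (tri p a t).derivative.eval x = 0) : x = 0 ∨ x = c := by
  rw [tri_deriv_eval p hp] at hx
  rcases mul_eq_zero.mp hx with h | h
  · exact Or.inl (eq_zero_of_pow_eq_zero h)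
  · right
    have hp0 : (p : E) ≠ 0 := by exact_mod_cast (by omega : p ≠ 0)
    apply mul_left_cancel₀ hp0
    rw [hc]; linear_combination h

lemma tri_simple {E : Type*} [Field E] [CharZero E] (p : ℕ) (hp : 3 ≤ p) (a t c : E)
    (hc : (p : E) * c = -(((p : E) - 1) * a)) (hct : (tri p a t).eval t = c)
    (n : ℕ) (hne : ∀ i, 1 ≤ i → i ≤ n + 1 → (fun y => (tri p a t).eval y)^[i] 0 ≠ 0)
    (x : E) (h1 : (polyIter (tri p a t) n).eval x = 0)
    (h2 : (polyIter (tri p a t) n).derivative.eval x = 0) : x = c := by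
  rw [polyIter_deriv_eval, Finset.prod_eq_zero_iff] at h2
  obtain ⟨j, hj, h⟩ := h2
  rw [Finset.mem_range] at hj
  rw [polyIter_eval, show n = (n - j) + j by omega, Function.iterate_add_apply] at h1
  rcases tri_crit p hp a t c hc _ h with h | h
  · rw [h] at h1
    exact absurd h1 (hne _ (by omega) (by omega))
  · rcases Nat.eq_zero_or_pos j with rfl | hj0
    · simpa using h
    · rw [h, tri_iter_c p hp a t c hct] at h1
      exact absurd h1 (hne _ (by omega) (by omega))

lemma tri_two {E : Type*} [Field E] [CharZero E] (p : ℕ) (hp : 3 ≤ p) (a t c : E)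
    (hc : (p : E) * c = -(((p : E) - 1) * a)) (hct : (tri p a t).eval t = c)
    (n : ℕ) (hn : 1 ≤ n)
    (hne : ∀ i, 1 ≤ i → i ≤ n + 1 → (fun y => (tri p a t).eval y)^[i] 0 ≠ 0)
    (h1 : (polyIter (tri p a t) n).eval c = 0) :
    (polyIter (tri p a t) n).derivative.derivative.eval c ≠ 0 := by
  obtain ⟨m, rfl⟩ : ∃ m, n = m + 1 := ⟨n - 1, by omega⟩
  have hp0 : (p : E) ≠ 0 := by exact_mod_cast (by omega : p ≠ 0)
  have hd0 : (tri p a t).derivative.eval c = 0 := by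
    rw [tri_deriv_eval p hp, hc]; ring
  have hc0 : c ≠ 0 := by
    have := tri_iter_c p hp a t c hct 0
    rw [Function.iterate_zero_apply] at this
    rw [this]; exact hne _ (by omega) (by omega)
  have hdd : (tri p a t).derivative.derivative.eval c = c ^ (p - 2) * p := by
    rw [tri_deriv p hp, derivative_mul]
    simp only [derivative_add, derivative_C_mul, derivative_X, derivative_C, eval_add, eval_mul,
      eval_pow, eval_X, eval_C, eval_one, eval_zero, hc]
    ring
  have key : (polyIter (tri p a t) m).derivative.eval ((tri p a t).eval c) ≠ 0 := by
    rw [polyIter_deriv_eval, Finset.prod_ne_zero_iff]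
    intro j hj h
    rw [Finset.mem_range] at hj
    have e : (fun y => (tri p a t).eval y)^[j] ((tri p a t).eval c) =
      (fun y => (tri p a t).eval y)^[j + 1] c := (Function.iterate_succ_apply _ _ _).symm
    rw [e] at h
    rcases tri_crit p hp a t c hc _ h with h | h
    · rw [tri_iter_c p hp a t c hct] at h
      exact absurd h (hne _ (by omega) (by omega))
    · rw [polyIter_eval, show m + 1 = (m - j) + (j + 1) by omega, Function.iterate_add_apply, h,
        tri_iter_c p hp a t c hct] at h1
      exact absurd h1 (hne _ (by omega) (by omega))
  rw [polyIter_succ', derivative_comp, derivative_mul]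
  simp only [eval_add, eval_mul, hd0, hdd, eval_comp, zero_mul, add_zero]
  exact mul_ne_zero (mul_ne_zero (pow_ne_zero _ hc0) hp0) key

end Tri

section PrimeExistence

/-- The denominator `p t^(p-1) + p - 1`. -/
def triD {R : Type*} [CommRing R] (p : ℕ) (t : R) : R := (p : R) * t ^ (p - 1) + (p : R) - 1

/-- Exponents of the denominators of the critical orbit. -/
def triE (p : ℕ) : ℕ → ℕ
  | 0 => 0
  | j + 1 => p * triE p j + 1

/-- Numerators of the critical orbit. -/
def triN {R : Type*} [CommRing R] (p : ℕ) (t : R) : ℕ → R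
  | 0 => 0
  | j + 1 => triD p t * triN p t j ^ p
      - (p : R) * (t ^ p + t) * triD p t ^ triE p j * triN p t j ^ (p - 1)
      + t * triD p t ^ (p * triE p j + 1)

lemma triD_map {R S : Type*} [CommRing R] [CommRing S] (f : R →+* S) (p : ℕ) (t : R) :
    f (triD p t) = triD p (f t) := by
  simp [triD]

lemma triN_map {R S : Type*} [CommRing R] [CommRing S] (f : R →+* S) (p : ℕ) (t : R) (j : ℕ) :
    f (triN p t j) = triN p (f t) j := by
  induction j with
  | zero => simp [triN]
  | succ j ih => simp [triN, triD_map, ih]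

section ModP

variable (p : ℕ) [hp : Fact p.Prime]

lemma triD_modp : triD p (X : (ZMod p)[X]) = -1 := by
  have : ((p : ℕ) : (ZMod p)[X]) = 0 := by
    rw [← map_natCast (C : ZMod p →+* _), ZMod.natCast_self, map_zero]
  simp [triD, this]

lemma triN_modp (j : ℕ) : ∃ u : (ZMod p), u ≠ 0 ∧
    triN p (X : (ZMod p)[X]) (j + 1) = - triN p (X : (ZMod p)[X]) j ^ p + C u * X := by
  have : ((p : ℕ) : (ZMod p)[X]) = 0 := by
    rw [← map_natCast (C : ZMod p →+* _), ZMod.natCast_self, map_zero]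
  refine ⟨(-1) ^ (p * triE p j + 1), pow_ne_zero _ (by simp), ?_⟩
  rw [triN, triD_modp, this]
  simp only [C_pow, C_neg, C_1]
  ring

lemma triN_modp_deriv (j : ℕ) : IsUnit (triN p (X : (ZMod p)[X]) (j + 1)).derivative := by
  have : ((p : ℕ) : (ZMod p)[X]) = 0 := by
    rw [← map_natCast (C : ZMod p →+* _), ZMod.natCast_self, map_zero]
  obtain ⟨u, hu, h⟩ := triN_modp p j
  have : (triN p (X : (ZMod p)[X]) (j + 1)).derivative = C u := by
    rw [h]
    simp [derivative_pow, this]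
  rw [this]
  exact isUnit_C.mpr (isUnit_iff_ne_zero.mpr hu)

lemma triN_modp_deg (j : ℕ) : (triN p (X : (ZMod p)[X]) (j + 1)).natDegree = p ^ j := by
  induction j with
  | zero =>
    obtain ⟨u, hu, h⟩ := triN_modp p 0
    rw [h, triN, zero_pow hp.out.ne_zero, neg_zero, zero_add, pow_zero, natDegree_C_mul_X _ hu]
  | succ j ih =>
    obtain ⟨u, hu, h⟩ := triN_modp p (j + 1)
    have h1 : (- triN p (X : (ZMod p)[X]) (j + 1) ^ p).natDegree = p ^ (j + 1) := by
      rw [natDegree_neg, natDegree_pow, ih, pow_succ, mul_comm]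
    rw [h, natDegree_add_eq_left_of_natDegree_lt, h1]
    rw [h1, natDegree_C_mul_X _ hu]
    exact Nat.one_lt_pow (by omega) hp.out.one_lt

lemma triN_modp_ne (j : ℕ) (hj : 1 ≤ j) : triN p (X : (ZMod p)[X]) j ≠ 0 := by
  obtain ⟨i, rfl⟩ : ∃ i, j = i + 1 := ⟨j - 1, by omega⟩
  intro h
  have := triN_modp_deg p i
  rw [h, natDegree_zero] at this
  exact absurd this.symm (pow_ne_zero _ hp.out.ne_zero)

lemma triN_modp_not_dvd (m : ℕ) (hm : 1 ≤ m) (M : ℕ) :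
    ¬ triN p (X : (ZMod p)[X]) m ∣ ((triN p (X : (ZMod p)[X]) m).derivative *
      (triD p X * ∏ i ∈ Finset.Ico 1 m, triN p (X : (ZMod p)[X]) i)) ^ M := by
  intro h
  obtain ⟨l, rfl⟩ : ∃ l, m = l + 1 := ⟨m - 1, by omega⟩
  have hu := triN_modp_deriv p l
  have hsf : Squarefree (triN p (X : (ZMod p)[X]) (l + 1)) := by
    apply Separable.squarefree
    rw [separable_def]
    exact (isCoprime_one_right).of_isCoprime_of_dvd_right (hu.dvd) 
  have hP0 : ∏ i ∈ Finset.Ico 1 (l + 1), triN p (X : (ZMod p)[X]) i ≠ 0 := by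
    rw [Finset.prod_ne_zero_iff]
    intro i hi
    exact triN_modp_ne p i (Finset.mem_Ico.mp hi).1
  have h2 := (h.trans (pow_dvd_pow _ (Nat.le_succ M)))
  rw [hsf.dvd_pow_iff_dvd (Nat.succ_ne_zero M), hu.dvd_mul_left, triD_modp, neg_one_mul,
    dvd_neg] at h2
  have h3 := natDegree_le_of_dvd h2 hP0
  rw [natDegree_prod, triN_modp_deg] at h3
  · have h4 : ∑ i ∈ Finset.Ico 1 (l + 1), (triN p (X : (ZMod p)[X]) i).natDegree
        = ∑ i ∈ Finset.range l, p ^ i := by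
      rw [Finset.sum_Ico_eq_sum_range]
      refine Finset.sum_congr (by simp) fun i _ => ?_
      rw [add_comm, triN_modp_deg]
    rw [h4] at h3
    exact absurd (Nat.geomSum_lt hp.out.two_le (fun k hk => Finset.mem_range.mp hk)) (not_lt.mpr h3)
  · intro i hi
    exact triN_modp_ne p i (Finset.mem_Ico.mp hi).1

end ModP

/-- The radical criterion for divisibility in a principal ideal domain. -/
lemma exists_dvd_pow_of_irreducible {R : Type*} [CommRing R] [IsDomain R] [IsPrincipalIdealRing R]
    (N H : R) (hN : N ≠ 0) (h : ∀ Q : R, Irreducible Q → Q ∣ N → Q ∣ H) : ∃ M, N ∣ H ^ M := by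
  have : H ∈ (Ideal.span {N}).radical := by
    rw [Ideal.radical_eq_sInf, Submodule.mem_sInf]
    rintro J ⟨hJ, hJp⟩
    have hNJ : N ∈ J := hJ (Ideal.mem_span_singleton_self N)
    obtain ⟨Q, rfl⟩ := (IsPrincipalIdealRing.principal J).principal
    change H ∈ Ideal.span {Q}
    change N ∈ Ideal.span {Q} at hNJ
    rw [Ideal.mem_span_singleton] at hNJ ⊢
    have hQ0 : Q ≠ 0 := by
      rintro rfl; exact hN (zero_dvd_iff.mp hNJ)
    exact h Q ((Ideal.span_singleton_prime hQ0).mp hJp).irreducible hNJ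
  obtain ⟨M, hM⟩ := this
  exact ⟨M, Ideal.mem_span_singleton.mp hM⟩

lemma triN_derivative_map {R S : Type*} [CommRing R] [CommRing S] (f : R →+* S) (p m M : ℕ) :
    (((triN p (X : R[X]) m).derivative *
      (triD p X * ∏ i ∈ Finset.Ico 1 m, triN p (X : R[X]) i)) ^ M).map f =
    ((triN p (X : S[X]) m).derivative *
      (triD p X * ∏ i ∈ Finset.Ico 1 m, triN p (X : S[X]) i)) ^ M := by
  have h1 : ∀ i, (triN p (X : R[X]) i).map f = triN p (X : S[X]) i := by
    intro i
    have := triN_map (mapRingHom f) p (X : R[X]) i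
    simpa using this
  have h2 : (triD p (X : R[X])).map f = triD p (X : S[X]) := by
    have := triD_map (mapRingHom f) p (X : R[X])
    simpa using this
  rw [Polynomial.map_pow, Polynomial.map_mul, Polynomial.map_mul, Polynomial.map_prod, h2,
    ← derivative_map, h1]
  simp only [h1]

lemma exists_good_prime (k : Type*) [Field k] [CharZero k] (p : ℕ) (hp : p.Prime) (m : ℕ)
    (hm : 1 ≤ m) : ∃ Q : k[X], Irreducible Q ∧ ¬ Q ∣ triD p X ∧
      Q ∣ triN p X m ∧ ¬ Q ^ 2 ∣ triN p X m ∧ ∀ i, 1 ≤ i → i < m → ¬ Q ∣ triN p X i := by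
  have hfact : Fact p.Prime := ⟨hp⟩
  by_contra hcon
  push Not at hcon
  have hZ : triN p (X : ℤ[X]) m ≠ 0 := by
    intro h
    have h1 : (triN p (X : ℤ[X]) m).map (Int.castRingHom (ZMod p)) = triN p X m := by
      simpa using triN_map (mapRingHom (Int.castRingHom (ZMod p))) p (X : ℤ[X]) m
    rw [h, Polynomial.map_zero] at h1
    exact triN_modp_ne p m hm h1.symm
  have hk : (triN p (X : ℤ[X]) m).map (Int.castRingHom k) = triN p X m := by
    simpa using triN_map (mapRingHom (Int.castRingHom k)) p (X : ℤ[X]) m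
  have hQm : (triN p (X : ℤ[X]) m).map (Int.castRingHom ℚ) = triN p X m := by
    simpa using triN_map (mapRingHom (Int.castRingHom ℚ)) p (X : ℤ[X]) m
  have hQk : (triN p (X : ℚ[X]) m).map (Rat.castHom k) = triN p X m := by
    simpa using triN_map (mapRingHom (Rat.castHom k)) p (X : ℚ[X]) m
  have hp1 : (triN p (X : ℤ[X]) m).map (Int.castRingHom (ZMod p)) = triN p X m := by
    simpa using triN_map (mapRingHom (Int.castRingHom (ZMod p))) p (X : ℤ[X]) m
  have hk0 : triN p (X : k[X]) m ≠ 0 := by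
    rw [← hk]
    exact (Polynomial.map_ne_zero_iff (RingHom.injective_int _)).mpr hZ
  obtain ⟨M, hM⟩ := exists_dvd_pow_of_irreducible (triN p (X : k[X]) m)
    ((triN p (X : k[X]) m).derivative *
      (triD p X * ∏ i ∈ Finset.Ico 1 m, triN p (X : k[X]) i)) hk0 (by
    intro Q hQ hQN
    by_cases hD : Q ∣ triD p X
    · exact dvd_mul_of_dvd_right (dvd_mul_of_dvd_left hD _) _
    by_cases h2 : Q ^ 2 ∣ triN p X m
    · refine dvd_mul_of_dvd_left ?_ _
      obtain ⟨g, hg⟩ := h2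
      rw [hg, derivative_mul, derivative_pow]
      refine dvd_add ?_ ?_
      · refine dvd_mul_of_dvd_left (dvd_mul_of_dvd_left (dvd_mul_of_dvd_right ?_ _) _) _
        simp
      · exact dvd_mul_of_dvd_left (dvd_pow_self Q two_ne_zero) _
    · obtain ⟨i, hi1, hi2, hi⟩ := hcon Q hQ hD hQN h2
      refine dvd_mul_of_dvd_right (dvd_mul_of_dvd_right (hi.trans ?_) _) _
      exact Finset.dvd_prod_of_mem _ (Finset.mem_Ico.mpr ⟨hi1, hi2⟩))
  rw [← triN_derivative_map (Rat.castHom k), ← hQk, Polynomial.map_dvd_map'] at hM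
  rw [← triN_derivative_map (Int.castRingHom ℚ), ← hQm] at hM
  have hpp : (triN p (X : ℤ[X]) m).primPart ∣ ((triN p (X : ℤ[X]) m).derivative *
      (triD p X * ∏ i ∈ Finset.Ico 1 m, triN p (X : ℤ[X]) i)) ^ M := by
    refine (isPrimitive_primPart _).dvd_of_fraction_map_dvd_fraction_map (K := ℚ) ?_
    refine dvd_trans ?_ hM
    exact Polynomial.map_dvd _ (primPart_dvd _)
  have h5 := Polynomial.map_dvd (Int.castRingHom (ZMod p)) hpp
  rw [triN_derivative_map] at h5
  apply triN_modp_not_dvd p m hm M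
  refine dvd_trans ?_ h5
  have h6 := congrArg (Polynomial.map (Int.castRingHom (ZMod p)))
    (eq_C_content_mul_primPart (triN p (X : ℤ[X]) m))
  rw [hp1, Polynomial.map_mul, map_C] at h6
  have h7 : Int.castRingHom (ZMod p) (triN p (X : ℤ[X]) m).content ≠ 0 := by
    intro h
    rw [h, C_0, zero_mul] at h6
    exact triN_modp_ne p m hm h6
  rw [h6]
  exact (isUnit_C.mpr (isUnit_iff_ne_zero.mpr h7)).mul_left_dvd.mpr dvd_rfl

end PrimeExistence

section Final

universe u

lemma polyIter_X_pow {R : Type*} [CommRing R] (p n : ℕ) :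
    polyIter (X ^ p : R[X]) n = X ^ (p ^ n) := by
  induction n with
  | zero => simp [polyIter]
  | succ n ih => simp [polyIter, ih, ← pow_mul, pow_succ]

lemma tri_orbit_mem {A : Type*} [CommRing A] (P : Ideal A) (p : ℕ) (hp : 3 ≤ p) (a t : A)
    (ht : t ∈ P) (n : ℕ) :
    (fun y => (tri p a t).eval y)^[n] 0 ∈ P ∧
      (fun y => (tri p a t).eval y)^[n + 1] 0 - t ∈ P ^ 2 := by
  have step : ∀ x ∈ P, (tri p a t).eval x - t ∈ P ^ 2 := by
    intro x hx
    have h : (tri p a t).eval x - t = x ^ 2 * (x ^ (p - 2) + a * x ^ (p - 3)) := by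
      obtain ⟨q, rfl⟩ : ∃ q, p = q + 3 := ⟨p - 3, by omega⟩
      simp only [tri, eval_add, eval_mul, eval_pow, eval_X, eval_C]
      simp only [show q + 3 - 1 = q + 2 by omega, show q + 3 - 2 = q + 1 by omega,
        show q + 3 - 3 = q by omega]
      ring
    rw [h]
    exact Ideal.mul_mem_right _ _ (Ideal.pow_mem_pow hx 2)
  induction n with
  | zero => exact ⟨P.zero_mem, step 0 P.zero_mem⟩
  | succ n ih =>
    have h1 : (fun y => (tri p a t).eval y)^[n + 1] 0 ∈ P := by
      have := P.add_mem (Ideal.pow_le_self two_ne_zero ih.2) ht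
      simpa using this
    refine ⟨h1, ?_⟩
    rw [Function.iterate_succ_apply']
    exact step _ h1

lemma tri_irreducible {A : Type*} [CommRing A] [IsDomain A] (P : Ideal A) [hP : P.IsPrime]
    (p : ℕ) (hp : 3 ≤ p) (a t : A) (ha : a ∈ P) (ht : t ∈ P) (ht2 : t ∉ P ^ 2) (n : ℕ) :
    Irreducible (polyIter (tri p a t) n) := by
  have hmon := polyIter_monic (tri p a t) (tri_monic p hp a t).1
    (by rw [(tri_monic p hp a t).2]; omega)
  rw [(tri_monic p hp a t).2] at hmon
  rcases Nat.eq_zero_or_pos n with rfl | hn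
  · exact irreducible_X
  refine IsEisensteinAt.irreducible (𝓟 := P) ⟨?_, ?_, ?_⟩ hP (hmon n).1.isPrimitive ?_
  · rw [(hmon n).1.leadingCoeff]
    exact fun h => hP.ne_top ((Ideal.eq_top_iff_one _).mpr h)
  · intro i hi
    rw [(hmon n).2] at hi
    have h1 : (polyIter (tri p a t) n).map (Ideal.Quotient.mk P) = X ^ (p ^ n) := by
      rw [polyIter_map, tri_map, Ideal.Quotient.eq_zero_iff_mem.mpr ha,
        Ideal.Quotient.eq_zero_iff_mem.mpr ht, ← polyIter_X_pow]
      simp [tri]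
    have h2 := congrArg (fun q => q.coeff i) h1
    simp only [coeff_map, coeff_X_pow, hi.ne, if_false] at h2
    exact Ideal.Quotient.eq_zero_iff_mem.mp h2
  · rw [coeff_zero_eq_eval_zero, polyIter_eval]
    obtain ⟨m, rfl⟩ : ∃ m, n = m + 1 := ⟨n - 1, by omega⟩
    intro h
    have h1 := (tri_orbit_mem P p hp a t ht m).2
    exact ht2 ((Submodule.sub_mem_iff_right _ h).mp h1)
  · rw [(hmon n).2]; exact pow_pos (by omega) _

lemma tri_orbit_eq {R : Type*} [CommRing R] (p : ℕ) (hp : 3 ≤ p) (a t : R)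
    (h : a * triD p t = -((p : R) * (t ^ p + t))) (j : ℕ) :
    (fun y => (tri p a t).eval y)^[j] 0 * triD p t ^ triE p j = triN p t j := by
  induction j with
  | zero => simp [triN]
  | succ j ih =>
    rw [Function.iterate_succ_apply', triN, ← ih]
    set f := (fun y => (tri p a t).eval y)^[j] 0
    set e := triE p j
    have : triE p (j + 1) = p * e + 1 := rfl
    rw [this]
    obtain ⟨q, rfl⟩ : ∃ q, p = q + 1 := ⟨p - 1, by omega⟩
    simp only [tri, eval_add, eval_mul, eval_pow, eval_X, eval_C, Nat.add_sub_cancel]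
    linear_combination (f ^ q * triD (q + 1) t ^ ((q + 1) * e)) * h

lemma tri_c {R : Type*} [CommRing R] (p : ℕ) (hp : 3 ≤ p) (a t : R)
    (h : a * triD p t = -((p : R) * (t ^ p + t))) :
    (p : R) * (tri p a t).eval t = -(((p : R) - 1) * a) := by
  simp only [tri, eval_add, eval_mul, eval_pow, eval_X, eval_C]
  rw [triD] at h
  linear_combination h

lemma swap_generic {A K : Type u} [CommRing A] [IsDedekindDomain A] [Field K]
    [Algebra A K] [IsFractionRing A K] (k : Type u) [Field k] [CharZero k] (g : k →+* A)
    (p : ℕ) (hp : 3 ≤ p) (a t : A) (h : a * triD p t = -((p : A) * (t ^ p + t)))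
    (m : Ideal A) [hmax : m.IsMaximal] (hm0 : m ≠ ⊥) (n : ℕ) (hn : 1 ≤ n)
    (hm : m = Ideal.span {(fun y => (tri p a t).eval y)^[n + 2] 0})
    (hne : ∀ i, 1 ≤ i → i ≤ n + 1 → (fun y => (tri p a t).eval y)^[i] 0 ∉ m)
    (φ : K[X]) (hφ : (tri p a t).map (algebraMap A K) = φ)
    (hsep : (polyIter φ n).Separable) :
    ∃ σ : Gal((polyIter φ n).SplittingField/K), ∃ a b : (polyIter φ n).SplittingField, a ≠ b ∧
      a ∈ (polyIter φ n).rootSet (polyIter φ n).SplittingField ∧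
      b ∈ (polyIter φ n).rootSet (polyIter φ n).SplittingField ∧ σ a = b ∧ σ b = a ∧
      ∀ x ∈ (polyIter φ n).rootSet (polyIter φ n).SplittingField, x ≠ a → x ≠ b → σ x = x := by
  subst hφ
  have hc := tri_c p hp a t h
  have hcz : ∀ (E : Type u) [Field E] (f : A →+* E), CharZero E := by
    intro E _ f
    exact charZero_of_injective_ringHom (f.comp g).injective
  have : CharZero m.ResidueField := hcz _ (algebraMap A m.ResidueField)
  have hcE : ∀ (E : Type u) [Field E] (f : A →+* E),
      (p : E) * f ((tri p a t).eval t) = -(((p : E) - 1) * f a) := by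
    intro E _ f
    have := congrArg f hc
    simpa only [map_mul, map_neg, map_sub, map_natCast, map_one] using this
  have hctE : ∀ (E : Type u) [Field E] (f : A →+* E),
      (tri p (f a) (f t)).eval (f t) = f ((tri p a t).eval t) := by
    intro E _ f
    rw [← tri_map, eval_map_apply]
  have hneE : ∀ (E : Type u) [Field E] (f : A →+* E), (∀ a ∈ m, f a = 0) →
      ∀ i, 1 ≤ i → i ≤ n + 1 → (fun y => (tri p (f a) (f t)).eval y)^[i] 0 ≠ 0 := by
    intro E _ f hf i h1 h2 h3
    apply hne i h1 h2
    rw [← polyIter_eval] at h3 ⊢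
    rw [← tri_map, ← polyIter_map, ← map_zero f, eval_map_apply] at h3
    have hk : m = RingHom.ker f := hmax.eq_of_le (RingHom.ker_ne_top f) hf
    rw [hk, RingHom.mem_ker, h3, map_zero]
  have hFc : (polyIter (tri p a t) n).eval ((tri p a t).eval t) =
      (fun y => (tri p a t).eval y)^[n + 2] 0 := by
    rw [polyIter_eval, tri_iter_c p hp a t _ rfl]
  rw [← polyIter_map] at hsep ⊢
  refine exists_swap_of_inertia (A := A) (K := K) _ (polyIter (tri p a t) n)
    (polyIter_monic _ (tri_monic p hp a t).1 (by rw [(tri_monic p hp a t).2]; omega) n).1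
    hsep m ((tri p a t).eval t) (by rw [hFc]; exact hm) hm0
    (by rw [polyIter_tri_deriv_c p hp a t _ hc n hn]; exact m.zero_mem) ?_ ?_
  · intro E _ f hf x h1 h2
    have := hcz E f
    rw [← eval_map, polyIter_map, tri_map] at h1
    rw [← eval_map, ← derivative_map, polyIter_map, tri_map] at h2
    exact tri_simple p hp _ _ _ (hcE E f) (hctE E f) n (hneE E f hf) x h1 h2
  · intro E _ f hf
    have := hcz E f
    rw [← eval_map, ← derivative_map, ← derivative_map, polyIter_map, tri_map]
    refine tri_two p hp _ _ _ (hcE E f) (hctE E f) n hn (hneE E f hf) ?_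
    rw [← tri_map, ← polyIter_map, eval_map_apply]
    apply hf
    rw [hFc, hm]
    exact Ideal.mem_span_singleton_self _

end Final

section Assembly

universe u

lemma loc_le {k : Type u} [Field k] (Q : k[X]) (hQ : (Ideal.span {Q}).IsPrime) :
    (Ideal.span {Q}).primeCompl ≤ nonZeroDivisors k[X] :=
  Ideal.primeCompl_le_nonZeroDivisors _

/-- The basic facts on the local ring of `k[t]` at an irreducible polynomial. -/
lemma loc_package {k : Type u} [Field k] (Q : k[X]) (hQ : Irreducible Q) :
    ∃ A : Subalgebra k[X] (RatFunc k), IsDedekindDomain A ∧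
      ∃ m : Ideal A, m.IsMaximal ∧ m ≠ ⊥ ∧ m = Ideal.span {algebraMap k[X] A Q} ∧
        (∀ x : k[X], ¬ Q ∣ x → IsUnit (algebraMap k[X] A x)) ∧
        (∀ x : k[X], algebraMap k[X] A x ∈ m ↔ Q ∣ x) := by
  have hp : (Ideal.span {Q}).IsPrime := (Ideal.span_singleton_prime hQ.ne_zero).mpr hQ.prime
  have hle := loc_le Q hp
  let A := Localization.subalgebra.ofField (RatFunc k) (Ideal.span {Q}).primeCompl hle
  have hloc : IsLocalization.AtPrime A (Ideal.span {Q}) :=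
    Localization.subalgebra.isLocalization_ofField (RatFunc k) _ hle
  have hded : IsDedekindDomain A := IsLocalization.isDedekindDomain k[X] hle A
  have hlr : IsLocalRing A := IsLocalization.AtPrime.isLocalRing A (Ideal.span {Q})
  have hmem : ∀ x : k[X], algebraMap k[X] A x ∈ IsLocalRing.maximalIdeal A ↔ Q ∣ x := by
    intro x
    rw [IsLocalization.AtPrime.to_map_mem_maximal_iff A (Ideal.span {Q}) x,
      Ideal.mem_span_singleton]
  refine ⟨A, hded, IsLocalRing.maximalIdeal A, inferInstance, ?_, ?_, ?_, hmem⟩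
  · intro h
    have h1 := (hmem Q).mpr dvd_rfl
    rw [h, Ideal.mem_bot] at h1
    exact hQ.ne_zero ((map_eq_zero_iff _ (IsLocalization.injective A hle)).mp h1)
  · rw [← IsLocalization.AtPrime.map_eq_maximalIdeal (Ideal.span {Q}) A, Ideal.map_span,
      Set.image_singleton]
  · intro x hx
    rw [IsLocalization.AtPrime.isUnit_to_map_iff A (Ideal.span {Q})]
    intro h
    exact hx (Ideal.mem_span_singleton.mp h)

/-- The polynomial of the theorem. -/
noncomputable abbrev phiP (k : Type u) [Field k] (p : ℕ) : (RatFunc k)[X] :=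
  X ^ p
    + C ((-(p : RatFunc k) * (RatFunc.X : RatFunc k) ^ p
          - (p : RatFunc k) * RatFunc.X) /
        ((p : RatFunc k) * RatFunc.X ^ (p - 1) + (p : RatFunc k) - 1)) * X ^ (p - 1)
    + C (RatFunc.X : RatFunc k)

lemma triD_ne {k : Type u} [Field k] [CharZero k] (p : ℕ) (hp : 3 ≤ p) :
    ¬ (X : k[X]) ∣ triD p (X : k[X]) := by
  rw [X_dvd_iff, coeff_zero_eq_eval_zero]
  have : (triD p (X : k[X])).eval 0 = (p : k) - 1 := by
    simp [triD, show p - 1 ≠ 0 by omega]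
  rw [this, sub_eq_zero]
  exact_mod_cast (by omega : p ≠ 1)

lemma phi_lift {k : Type u} [Field k] (p : ℕ)
    (A : Subalgebra k[X] (RatFunc k)) (hu : IsUnit (algebraMap k[X] A (triD p X))) :
    ∃ a : A, a * triD p (algebraMap k[X] A X) =
        -((p : A) * ((algebraMap k[X] A X) ^ p + algebraMap k[X] A X)) ∧
      (tri p a (algebraMap k[X] A X)).map (algebraMap A (RatFunc k)) = phiP k p := by
  rw [triD_map] at hu
  obtain ⟨u, hu⟩ := hu
  have hX : algebraMap A (RatFunc k) (algebraMap k[X] A X) = RatFunc.X := by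
    rw [← IsScalarTower.algebraMap_apply, RatFunc.algebraMap_X]
  have ha : (-((p : A) * ((algebraMap k[X] A X) ^ p + algebraMap k[X] A X)) * (u⁻¹ : Aˣ)) *
      triD p (algebraMap k[X] A X) =
        -((p : A) * ((algebraMap k[X] A X) ^ p + algebraMap k[X] A X)) := by
    rw [← hu, mul_assoc, Units.inv_mul, mul_one]
  refine ⟨_, ha, ?_⟩
  have h1 := congrArg (algebraMap A (RatFunc k)) ha
  have h2 : algebraMap A (RatFunc k) (triD p (algebraMap k[X] A X)) ≠ 0 := by
    rw [← hu]; exact (u.isUnit.map (algebraMap A (RatFunc k))).ne_zero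
  rw [map_mul, ← eq_div_iff h2] at h1
  rw [tri_map, h1, triD_map, hX]
  simp only [map_neg, map_mul, map_add, map_pow, map_natCast, hX]
  rw [tri, triD, phiP]
  congr 4
  ring

lemma phi_irreducible {k : Type u} [Field k] [CharZero k] (p : ℕ) (hp : 3 ≤ p) (n : ℕ) :
    Irreducible (polyIter (phiP k p) n) := by
  obtain ⟨A, hded, m, hmax, hm0, hm, hunit, hmem⟩ := loc_package (X : k[X]) irreducible_X
  obtain ⟨a, ha, hφ⟩ := phi_lift p A (hunit _ (triD_ne p hp))
  have htm : algebraMap k[X] A X ∈ m := (hmem X).mpr dvd_rfl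
  have ht0 : algebraMap k[X] A X ≠ 0 := by
    intro h
    rw [h] at hm
    exact hm0 (by rw [hm]; simp)
  have ham : a ∈ m := by
    have h1 : a * triD p (algebraMap k[X] A X) ∈ m := by
      rw [ha]
      exact m.neg_mem (m.mul_mem_left _ (m.add_mem (m.pow_mem_of_mem htm p (by omega)) htm))
    refine (hmax.isPrime.mem_or_mem h1).resolve_right ?_
    rw [← triD_map, hmem]
    exact triD_ne p hp
  have h2 : algebraMap k[X] A X ∉ m ^ 2 := by
    intro h
    rw [hm, Ideal.span_singleton_pow, Ideal.mem_span_singleton] at h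
    obtain ⟨y, hy⟩ := h
    have h3 : algebraMap k[X] A X * y = 1 := by
      apply mul_left_cancel₀ ht0
      linear_combination -hy
    exact hmax.ne_top ((Ideal.eq_top_iff_one _).mpr (h3 ▸ m.mul_mem_right _ htm))
  rw [← hφ, ← polyIter_map, ← Monic.irreducible_iff_irreducible_map_fraction_map]
  · exact tri_irreducible m p hp a _ ham htm h2 n
  · exact (polyIter_monic _ (tri_monic p hp a _).1 (by rw [(tri_monic p hp a _).2]; omega) n).1

lemma phi_swap {k : Type u} [Field k] [CharZero k] (p : ℕ) (hpp : p.Prime) (hp : 3 ≤ p) (n : ℕ)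
    (hn : 1 ≤ n) (φ : (RatFunc k)[X]) (hphi : φ = phiP k p) :
    ∃ σ : Gal((polyIter φ n).SplittingField/(RatFunc k)),
      ∃ a b : (polyIter φ n).SplittingField, a ≠ b ∧
      a ∈ (polyIter φ n).rootSet (polyIter φ n).SplittingField ∧
      b ∈ (polyIter φ n).rootSet (polyIter φ n).SplittingField ∧ σ a = b ∧ σ b = a ∧
      ∀ x ∈ (polyIter φ n).rootSet (polyIter φ n).SplittingField, x ≠ a → x ≠ b → σ x = x := by
  obtain ⟨Q, hQ, hQD, hQN, hQ2, hQi⟩ := exists_good_prime k p hpp (n + 2) (by omega)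
  obtain ⟨A, hded, m, hmax, hm0, hm, hunit, hmem⟩ := loc_package Q hQ
  have hDu := hunit _ hQD
  obtain ⟨a, ha, hφ⟩ := phi_lift p A hDu
  have horb := tri_orbit_eq p hp a _ ha
  rw [triD_map] at hDu
  have hchar : CharZero (RatFunc k) := charZero_of_injective_algebraMap
    (FaithfulSMul.algebraMap_injective k (RatFunc k))
  refine swap_generic k ((algebraMap k[X] A).comp C) p hp a (algebraMap k[X] A X) ha m hm0 n hn
    ?_ ?_ φ (hφ.trans hphi.symm) (by rw [hphi]; exact (phi_irreducible p hp n).separable)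
  · obtain ⟨v, hv⟩ := hQN
    have hvu : IsUnit (algebraMap k[X] A v) := by
      apply hunit
      rintro ⟨w, rfl⟩
      exact hQ2 ⟨w, by rw [hv]; ring⟩
    have h1 := horb (n + 2)
    rw [← triN_map, hv, map_mul] at h1
    rw [hm, ← Ideal.span_singleton_mul_right_unit hvu, ← h1,
      Ideal.span_singleton_mul_right_unit (hDu.pow _)]
  · intro i hi1 hi2 h
    have h1 := m.mul_mem_right (triD p (algebraMap k[X] A X) ^ triE p i) h
    rw [horb, ← triN_map, hmem] at h1
    exact hQi i hi1 (by omega) h1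

end Assembly

/-- For `K = k(t)` with `k` of characteristic zero and a prime `p ≥ 3`, the
trinomial `φ_p = x^p + ((-pt^p - pt)/(pt^{p-1} + p - 1)) x^{p-1} + t` has surjective arboreal
representation: `[K_n : K] = (p!)^{1+p+⋯+p^{n-1}}` for every `n ≥ 1`, where `K_n` is the
splitting field of `φ_p^n` over `K`. -/
theorem stmt_9 (k : Type*) [Field k] [CharZero k] (p : ℕ) (hp : p.Prime) (hp3 : 3 ≤ p) :
    ∀ n : ℕ, 1 ≤ n →
      Module.finrank (RatFunc k)
        ((polyIter
          (X ^ p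
            + C ((-(p : RatFunc k) * (RatFunc.X : RatFunc k) ^ p
                  - (p : RatFunc k) * RatFunc.X) /
                ((p : RatFunc k) * RatFunc.X ^ (p - 1) + (p : RatFunc k) - 1)) * X ^ (p - 1)
            + C (RatFunc.X : RatFunc k)) n).SplittingField)
      = (Nat.factorial p) ^ (∑ i ∈ Finset.range n, p ^ i) := by
  intro n _
  have hchar : CharZero (RatFunc k) := charZero_of_injective_algebraMap
    (FaithfulSMul.algebraMap_injective k (RatFunc k))
  have hφ : phiP k p = tri p _ _ := rfl
  refine finrank_of_swaps (phiP k p) (by rw [hφ]; exact (tri_monic p hp3 _ _).1) p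
    (by rw [hφ]; exact (tri_monic p hp3 _ _).2) hp hp3 (phi_irreducible p hp3) ?_ n
  intro n hn
  exact phi_swap p hp hp3 n hn _ rfl
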